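/- The function η̄ : (0,∞) → ℝ defined by η̄(t) = t^{−q}·[κ·b(t) − t·b′(t)], where b(t) = t²·φ(t), is strictly increasing on (0,∞), takes only positive values, and satisfies lim_{t→0⁺} η̄(t) = 0 and lim_{t→∞} η̄(t) = +∞. -/

import Mathlib

lemma aux_sm {f f' : ℝ → ℝ} (hf : ∀ t > 0, HasDerivAt f (f' t) t) (h : ∀ t > 0, 0 < f' t) :
    StrictMonoOn f (Set.Ioi 0) := by
  apply strictMonoOn_of_deriv_pos (convex_Ioi 0)
  · exact fun t ht => (hf t ht).continuousAt.continuousWithinAt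
  · intro t ht
    rw [interior_Ioi] at ht
    rw [(hf t ht).deriv]; exact h t ht

lemma aux_m {f f' : ℝ → ℝ} (hf : ∀ t > 0, HasDerivAt f (f' t) t) (h : ∀ t > 0, 0 ≤ f' t) :
    MonotoneOn f (Set.Ioi 0) := by
  apply monotoneOn_of_deriv_nonneg (convex_Ioi 0)
  · exact fun t ht => (hf t ht).continuousAt.continuousWithinAt
  · rw [interior_Ioi]
    exact fun t ht => (hf t ht).differentiableAt.differentiableWithinAt
  · intro t ht
    rw [interior_Ioi] at ht
    rw [(hf t ht).deriv]; exact h t ht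

theorem aux_main (l m q κ : ℝ) (g g1 g2 : ℝ → ℝ)
    (hl : 1 < l) (hlm : l ≤ m)
    (hg : ∀ t > 0, 0 < g t)
    (d1 : ∀ t > 0, HasDerivAt g (g1 t) t)
    (d2 : ∀ t > 0, HasDerivAt g1 (g2 t) t)
    (h0 : Filter.Tendsto g (nhdsWithin 0 (Set.Ioi 0)) (nhds 0))
    (hp : ∀ t > 0, 0 < g1 t)
    (h3l : ∀ t > 0, (l - 2) * g1 t ≤ t * g2 t)
    (h3m : ∀ t > 0, t * g2 t ≤ (m - 2) * g1 t)
    (hmκ : m < κ) (hq : 0 < q) (hqH : q < ((κ - 1) * l - m * (m - 1)) / (κ - l)) :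
    StrictMonoOn (fun t : ℝ => t ^ (1 - q) * ((κ - 1) * g t - t * g1 t)) (Set.Ioi 0) ∧
    (∀ t > 0, 0 < t ^ (1 - q) * ((κ - 1) * g t - t * g1 t)) ∧
    Filter.Tendsto (fun t : ℝ => t ^ (1 - q) * ((κ - 1) * g t - t * g1 t))
      (nhdsWithin 0 (Set.Ioi 0)) (nhds 0) ∧
    Filter.Tendsto (fun t : ℝ => t ^ (1 - q) * ((κ - 1) * g t - t * g1 t))
      Filter.atTop Filter.atTop := by
  have hκl : 0 < κ - l := by linarith
  rw [lt_div_iff₀ hκl] at hqH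
  have hql : q < l := by
    by_contra hc
    push Not at hc
    nlinarith [mul_le_mul_of_nonneg_right hc hκl.le]
  -- lower bound
  have hlow : ∀ t > 0, (l - 1) * g t ≤ t * g1 t := by
    have hm : MonotoneOn (fun t => t * g1 t - (l - 1) * g t) (Set.Ioi 0) := by
      apply aux_m (f' := fun t => (1 * g1 t + t * g2 t) - (l - 1) * g1 t)
      · intro t ht
        exact ((hasDerivAt_id t).mul (d2 t ht)).sub ((d1 t ht).const_mul (l - 1))
      · intro t ht
        have := h3l t ht
        linarith
    intro t0 ht0
    by_contra hc
    push Not at hc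
    have hlim : Filter.Tendsto (fun t => (l - 1) * g t) (nhdsWithin 0 (Set.Ioi 0)) (nhds 0) := by
      simpa using h0.const_mul (l - 1)
    have e1 := hlim.eventually (gt_mem_nhds (show 0 < (l - 1) * g t0 - t0 * g1 t0 by linarith))
    have e2 : ∀ᶠ t in nhdsWithin (0 : ℝ) (Set.Ioi 0), t ∈ Set.Ioo 0 t0 := Ioo_mem_nhdsGT ht0
    obtain ⟨t, h1, h2⟩ := (e1.and e2).exists
    have h3 := hm h2.1 ht0 h2.2.le
    have h4 := mul_pos h2.1 (hp t h2.1)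
    simp only at h3
    linarith
  have hup : ∀ t > 0, t * g1 t ≤ (m - 1) * g t := by
    have hm : MonotoneOn (fun t => (m - 1) * g t - t * g1 t) (Set.Ioi 0) := by
      apply aux_m (f' := fun t => (m - 1) * g1 t - (1 * g1 t + t * g2 t))
      · intro t ht
        exact ((d1 t ht).const_mul (m - 1)).sub ((hasDerivAt_id t).mul (d2 t ht))
      · intro t ht
        have := h3m t ht
        linarith
    intro t0 ht0
    by_contra hc
    push Not at hc
    obtain ⟨c, hcdef⟩ : ∃ c, c = t0 * g1 t0 - (m - 1) * g t0 := ⟨_, rfl⟩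
    have hc0 : 0 < c := by linarith
    have hg0 := hg t0 ht0
    have hmon : MonotoneOn (fun t => g t - c * Real.log t) (Set.Ioc 0 t0) := by
      have hd : ∀ t > 0, HasDerivAt (fun t => g t - c * Real.log t) (g1 t - c * t⁻¹) t :=
        fun t ht => (d1 t ht).sub ((Real.hasDerivAt_log ht.ne').const_mul c)
      apply monotoneOn_of_deriv_nonneg (convex_Ioc 0 t0)
      · exact fun t ht => (hd t ht.1).continuousAt.continuousWithinAt
      · rw [interior_Ioc]
        exact fun t ht => (hd t ht.1).differentiableAt.differentiableWithinAt
      · intro t ht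
        rw [interior_Ioc] at ht
        rw [(hd t ht.1).deriv]
        have h3 := hm ht.1 ht0 ht.2.le
        simp only at h3
        have h4 : 0 ≤ (m - 1) * g t := mul_nonneg (by linarith) (hg t ht.1).le
        have h5 : c ≤ g1 t * t := by linarith
        have h6 := (div_le_iff₀ ht.1).2 h5
        rw [div_eq_mul_inv] at h6
        linarith
    have hs : 0 < t0 * Real.exp (-(g t0 / c)) := by positivity
    have hs' : t0 * Real.exp (-(g t0 / c)) ≤ t0 := by
      apply mul_le_of_le_one_right ht0.le
      apply Real.exp_le_one_iff.2
      have : 0 < g t0 / c := by positivity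
      linarith
    have h7 := hmon ⟨hs, hs'⟩ ⟨ht0, le_rfl⟩ hs'
    simp only at h7
    rw [Real.log_mul ht0.ne' (Real.exp_pos _).ne', Real.log_exp] at h7
    have h8 : c * (g t0 / c) = g t0 := by field_simp
    have h9 := hg _ hs
    nlinarith
  have hmul : ∀ t > 0, ∀ a b : ℝ, (t : ℝ) ^ a * t ^ b = t ^ (a + b) := fun t ht a b =>
    (Real.rpow_add ht a b).symm
  have hgm : MonotoneOn (fun t => t ^ (1 - l) * g t) (Set.Ioi 0) := by
    apply aux_m (f' := fun t => ((1 - l) * t ^ (1 - l - 1)) * g t + t ^ (1 - l) * g1 t)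
    · intro t ht
      exact (Real.hasDerivAt_rpow_const (Or.inl ht.ne')).mul (d1 t ht)
    · intro t ht
      have e : t ^ (1 - l) = t ^ (1 - l - 1) * t := by
        rw [← Real.rpow_add_one ht.ne']; ring_nf
      have := hlow t ht
      have hpos := Real.rpow_pos_of_pos ht (1 - l - 1)
      rw [e]
      have := mul_nonneg hpos.le (sub_nonneg.2 this)
      linarith
  have hgm' : ∀ t > 0, g t = t ^ (l - 1) * (t ^ (1 - l) * g t) := by
    intro t ht
    rw [← mul_assoc, hmul t ht]; simp
  have hpos : ∀ t > 0, 0 < t ^ (1 - q) * ((κ - 1) * g t - t * g1 t) := by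
    intro t ht
    apply mul_pos (Real.rpow_pos_of_pos ht _)
    have := hup t ht
    have := mul_pos (sub_pos.2 hmκ) (hg t ht)
    linarith
  refine ⟨?_, hpos, ?_, ?_⟩
  · apply aux_sm (f' := fun t => ((1 - q) * t ^ (1 - q - 1)) * ((κ - 1) * g t - t * g1 t) +
      t ^ (1 - q) * ((κ - 1) * g1 t - (1 * g1 t + t * g2 t)))
    · intro t ht
      exact (Real.hasDerivAt_rpow_const (Or.inl ht.ne')).mul
        (((d1 t ht).const_mul (κ - 1)).sub ((hasDerivAt_id t).mul (d2 t ht)))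
    · intro t ht
      have e : t ^ (1 - q) = t ^ (1 - q - 1) * t := by
        rw [← Real.rpow_add_one ht.ne']; ring_nf
      have hP := Real.rpow_pos_of_pos ht (1 - q - 1)
      rw [e]
      have key : 0 < (1 - q) * ((κ - 1) * g t - t * g1 t) +
          t * ((κ - 1) * g1 t - (1 * g1 t + t * g2 t)) := by
        have a1 := mul_le_mul_of_nonneg_left (h3m t ht) ht.le
        have a2 := mul_pos (sub_pos.2 hqH) (hg t ht)
        have a3 := mul_le_mul_of_nonneg_left (hlow t ht) hq.le
        have a4 := mul_le_mul_of_nonneg_left (hlow t ht) (show 0 ≤ κ - 1 by linarith)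
        have a5 := mul_le_mul_of_nonneg_left (hup t ht) (show 0 ≤ m by linarith)
        linarith
      have := mul_pos hP key
      linarith
  · have hb : Filter.Tendsto (fun t : ℝ => (κ - 1) * g 1 * t ^ (l - q))
        (nhdsWithin 0 (Set.Ioi 0)) (nhds 0) := by
      have h := (Real.continuousAt_rpow_const 0 (l - q) (Or.inr (by linarith))).tendsto
      rw [Real.zero_rpow (by linarith)] at h
      simpa using (h.mono_left nhdsWithin_le_nhds).const_mul ((κ - 1) * g 1)
    apply tendsto_of_tendsto_of_tendsto_of_le_of_le' tendsto_const_nhds hb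
    · filter_upwards [self_mem_nhdsWithin] with t ht
      exact (hpos t ht).le
    · have e2 : ∀ᶠ t in nhdsWithin (0 : ℝ) (Set.Ioi 0), t ∈ Set.Ioo (0 : ℝ) 1 :=
        Ioo_mem_nhdsGT one_pos
      filter_upwards [e2] with t ht
      have h1 := hgm ht.1 (show (1 : ℝ) ∈ Set.Ioi 0 from Set.mem_Ioi.2 one_pos) ht.2.le
      simp only [Real.one_rpow, one_mul] at h1
      have h2 : g t ≤ t ^ (l - 1) * g 1 := by
        rw [hgm' t ht.1]
        exact mul_le_mul_of_nonneg_left h1 (Real.rpow_pos_of_pos ht.1 _).le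
      have h3 := mul_pos ht.1 (hp t ht.1)
      have h4 : (κ - 1) * g t - t * g1 t ≤ (κ - 1) * (t ^ (l - 1) * g 1) := by
        have := mul_le_mul_of_nonneg_left h2 (show 0 ≤ κ - 1 by linarith)
        linarith
      calc _ ≤ t ^ (1 - q) * ((κ - 1) * (t ^ (l - 1) * g 1)) :=
            mul_le_mul_of_nonneg_left h4 (Real.rpow_pos_of_pos ht.1 _).le
        _ = (κ - 1) * g 1 * (t ^ (1 - q) * t ^ (l - 1)) := by ring
        _ = _ := by rw [hmul t ht.1]; ring_nf
  · have hb : Filter.Tendsto (fun t : ℝ => (κ - m) * g 1 * t ^ (l - q))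
        Filter.atTop Filter.atTop :=
      (tendsto_rpow_atTop (by linarith)).const_mul_atTop
        (mul_pos (by linarith) (hg 1 one_pos))
    apply Filter.tendsto_atTop_mono' _ _ hb
    filter_upwards [Filter.eventually_ge_atTop 1] with t ht1
    have ht : 0 < t := by linarith
    have h1 := hgm (show (1 : ℝ) ∈ Set.Ioi 0 from Set.mem_Ioi.2 one_pos) ht ht1
    simp only [Real.one_rpow, one_mul] at h1
    have h2 : t ^ (l - 1) * g 1 ≤ g t := by
      rw [hgm' t ht]
      exact mul_le_mul_of_nonneg_left h1 (Real.rpow_pos_of_pos ht _).le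
    have h4 : (κ - m) * (t ^ (l - 1) * g 1) ≤ (κ - 1) * g t - t * g1 t := by
      have := mul_le_mul_of_nonneg_left h2 (show 0 ≤ κ - m by linarith)
      have := hup t ht
      linarith
    calc _ = (κ - m) * g 1 * (t ^ (1 - q) * t ^ (l - 1)) := by rw [hmul t ht]; ring_nf
      _ = t ^ (1 - q) * ((κ - m) * (t ^ (l - 1) * g 1)) := by ring
      _ ≤ _ := mul_le_mul_of_nonneg_left h4 (Real.rpow_pos_of_pos ht _).le

theorem stmt14 (l m q κ : ℝ) (phi : ℝ → ℝ)
    (hl : 1 < l) (hlm : l ≤ m)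
    (hphi_pos : ∀ t > 0, 0 < phi t)
    (hphi_C2 : ContDiffOn ℝ 2 phi (Set.Ioi 0))
    (hphi_1a : Filter.Tendsto (fun t => t * phi t) (nhdsWithin 0 (Set.Ioi 0)) (nhds 0))
    (hphi_1b : Filter.Tendsto (fun t => t * phi t) Filter.atTop Filter.atTop)
    (hphi_2 : StrictMonoOn (fun t => t * phi t) (Set.Ioi 0))
    (hphi_3pos : ∀ t > 0, 0 < deriv (fun s => s * phi s) t)
    (hphi_3l : ∀ t > 0, (l - 2) * deriv (fun s => s * phi s) t ≤ t * deriv (deriv (fun s => s * phi s)) t)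
    (hphi_3m : ∀ t > 0, t * deriv (deriv (fun s => s * phi s)) t ≤ (m - 2) * deriv (fun s => s * phi s) t)
    (hmκ : m < κ) (hq : 0 < q) (hqH : q < ((κ - 1) * l - m * (m - 1)) / (κ - l)) :
    StrictMonoOn
      (fun t : ℝ => t ^ (-q) * (κ * (t ^ 2 * phi t) - t * deriv (fun r => r ^ 2 * phi r) t))
      (Set.Ioi 0) ∧
    (∀ t > 0, 0 < t ^ (-q) * (κ * (t ^ 2 * phi t) - t * deriv (fun r => r ^ 2 * phi r) t)) ∧
    Filter.Tendsto
      (fun t : ℝ => t ^ (-q) * (κ * (t ^ 2 * phi t) - t * deriv (fun r => r ^ 2 * phi r) t))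
      (nhdsWithin 0 (Set.Ioi 0)) (nhds 0) ∧
    Filter.Tendsto
      (fun t : ℝ => t ^ (-q) * (κ * (t ^ 2 * phi t) - t * deriv (fun r => r ^ 2 * phi r) t))
      Filter.atTop Filter.atTop := by
  have hC : ContDiffOn ℝ 2 (fun s => s * phi s) (Set.Ioi 0) := contDiffOn_id.mul hphi_C2
  have d1 : ∀ t > 0, HasDerivAt (fun s => s * phi s) (deriv (fun s => s * phi s) t) t := by
    intro t ht
    exact ((hC.contDiffAt (Ioi_mem_nhds ht)).differentiableAt (by norm_num)).hasDerivAt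
  have hC1 : ContDiffOn ℝ 1 (deriv (fun s => s * phi s)) (Set.Ioi 0) :=
    hC.deriv_of_isOpen isOpen_Ioi (by norm_num)
  have d2 : ∀ t > 0, HasDerivAt (deriv (fun s => s * phi s))
      (deriv (deriv (fun s => s * phi s)) t) t := by
    intro t ht
    exact ((hC1.contDiffAt (Ioi_mem_nhds ht)).differentiableAt (by norm_num)).hasDerivAt
  obtain ⟨A, B, C, D⟩ := aux_main l m q κ (fun s => s * phi s) (deriv (fun s => s * phi s))
    (deriv (deriv (fun s => s * phi s))) hl hlm (fun t ht => mul_pos ht (hphi_pos t ht))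
    d1 d2 hphi_1a hphi_3pos hphi_3l hphi_3m hmκ hq hqH
  have E : Set.EqOn (fun t : ℝ => t ^ (1 - q) * ((κ - 1) * (t * phi t) -
      t * deriv (fun s => s * phi s) t))
      (fun t : ℝ => t ^ (-q) * (κ * (t ^ 2 * phi t) - t * deriv (fun r => r ^ 2 * phi r) t))
      (Set.Ioi 0) := by
    intro t ht
    have ht' : (0 : ℝ) < t := ht
    have hd : HasDerivAt (fun r => r ^ 2 * phi r)
        (1 * (t * phi t) + t * deriv (fun s => s * phi s) t) t := by
      have h := (hasDerivAt_id t).mul (d1 t ht)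
      refine h.congr_of_eventuallyEq (Filter.Eventually.of_forall fun r => ?_)
      simp only [Pi.mul_apply, id]
      ring
    have e : t ^ (1 - q) = t ^ (-q) * t := by
      rw [← Real.rpow_add_one ht'.ne']; ring_nf
    simp only
    rw [hd.deriv, e]
    ring
  refine ⟨A.congr E, fun t ht => ?_, ?_, ?_⟩
  · have h := B t ht
    have h2 := E ht
    simp only at h2
    rw [← h2]; exact h
  · exact C.congr' (Filter.eventuallyEq_of_mem self_mem_nhdsWithin E)
  · exact D.congr' (Filter.eventuallyEq_of_mem (Filter.Ioi_mem_atTop 0) E)
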